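/- For the graph A on the vertices of the convex (3n+4)-gon constructed from Boolean matrices M and N, the full convex (3n+4)-gon has a triangulation within A, i.e., there is a set of (3n+4)−3 pairwise noncrossing diagonals all satisfying A, if and only if there exist i, j, k in {1,…,n} such that M(i,k) and N(k,j) both hold. -/

import Mathlib

/-- Two chords `(a,b)` and `(c,d)`, each written with first coordinate smaller than
the second, cross iff `a<c<b<d` or `c<a<d<b`. -/
def Crosses (c d : ℕ × ℕ) : Prop :=
  (c.1 < d.1 ∧ d.1 < c.2 ∧ c.2 < d.2) ∨ (d.1 < c.1 ∧ c.1 < d.2 ∧ d.2 < c.2)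

/-- `T` is a triangulation of the subpolygon on vertices `p, p+1, …, q` within the
edge set `A`: a finite set of pairs `(k,l)` with `p ≤ k`, `k+2 ≤ l ≤ q`, `(k,l) ≠ (p,q)`,
all satisfying `A`, pairwise noncrossing, with `|T| = q - p - 2`. -/
def IsTriangulationOn (A : ℕ → ℕ → Prop) (p q : ℕ) (T : Finset (ℕ × ℕ)) : Prop :=
  (∀ c ∈ T, p ≤ c.1 ∧ c.1 + 2 ≤ c.2 ∧ c.2 ≤ q ∧ c ≠ (p, q) ∧ A c.1 c.2) ∧
  (∀ c ∈ T, ∀ d ∈ T, c ≠ d → ¬ Crosses c d) ∧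
  T.card = q - p - 2

/-- The edges `(a,b)`, written with `a < b`, of the graph on the vertices of a convex
`(3n+4)`-gon built from Boolean matrices `M` and `N`.  The vertices are labeled
counterclockwise `s = 0`, `x_i = i` (`1 ≤ i ≤ n`), `u = n+1`, `y_k = n+1+k`
(`1 ≤ k ≤ n`), `w = 2n+2`, `z_j = 2n+2+j` (`1 ≤ j ≤ n`), `t = 3n+3`. -/
def GadgetBase (n : ℕ) (M N : ℕ → ℕ → Prop) (a b : ℕ) : Prop :=
  -- the boundary edges of the polygon
  (b = a + 1 ∧ b ≤ 3 * n + 3) ∨ (a = 0 ∧ b = 3 * n + 3) ∨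
  -- (x_i, y_k) for M(i,k) = 1
  (∃ i k, 1 ≤ i ∧ i ≤ n ∧ 1 ≤ k ∧ k ≤ n ∧ a = i ∧ b = n + 1 + k ∧ M i k) ∨
  -- (y_k, z_j) for N(k,j) = 1
  (∃ k j, 1 ≤ k ∧ k ≤ n ∧ 1 ≤ j ∧ j ≤ n ∧ a = n + 1 + k ∧ b = 2 * n + 2 + j ∧ N k j) ∨
  -- (s, x_i)
  (∃ i, 1 ≤ i ∧ i ≤ n ∧ a = 0 ∧ b = i) ∨
  -- (s, z_j)
  (∃ j, 1 ≤ j ∧ j ≤ n ∧ a = 0 ∧ b = 2 * n + 2 + j) ∨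
  -- (x_i, z_j)
  (∃ i j, 1 ≤ i ∧ i ≤ n ∧ 1 ≤ j ∧ j ≤ n ∧ a = i ∧ b = 2 * n + 2 + j) ∨
  -- (x_i, u)
  (∃ i, 1 ≤ i ∧ i ≤ n ∧ a = i ∧ b = n + 1) ∨
  -- (u, y_k)
  (∃ k, 1 ≤ k ∧ k ≤ n ∧ a = n + 1 ∧ b = n + 1 + k) ∨
  -- (y_k, w)
  (∃ k, 1 ≤ k ∧ k ≤ n ∧ a = n + 1 + k ∧ b = 2 * n + 2) ∨
  -- (w, z_j)
  (∃ j, 1 ≤ j ∧ j ≤ n ∧ a = 2 * n + 2 ∧ b = 2 * n + 2 + j) ∨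
  -- (z_j, t)
  (∃ j, 1 ≤ j ∧ j ≤ n ∧ a = 2 * n + 2 + j ∧ b = 3 * n + 3)

/-- The symmetrization of `GadgetBase`. -/
def GadgetA (n : ℕ) (M N : ℕ → ℕ → Prop) (a b : ℕ) : Prop :=
  GadgetBase n M N a b ∨ GadgetBase n M N b a

/-- In a finite set `U` of pairs, every `(k, l)` with `k + 2 ≤ l` has a greatest `r < l` among
`k + 1` and the right endpoints of the members of `U` starting at `k`. -/
theorem exists_greatest_neighbor (U : Finset (ℕ × ℕ)) {k l : ℕ} (h : k + 2 ≤ l) :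
    ∃ r, k < r ∧ r < l ∧ (r = k + 1 ∨ (k, r) ∈ U) ∧ ∀ r' < l, (k, r') ∈ U → r' ≤ r := by
  classical
  set S := (Finset.Ioo k l).filter fun r => r = k + 1 ∨ (k, r) ∈ U with hS
  have hk : k + 1 ∈ S := by simp only [hS, Finset.mem_filter, Finset.mem_Ioo]; grind
  obtain ⟨r, hr, hmax⟩ := S.exists_max_image id ⟨_, hk⟩
  have hr' := hr
  simp only [hS, Finset.mem_filter, Finset.mem_Ioo] at hr'
  refine ⟨r, hr'.1.1, hr'.1.2, hr'.2, fun r' hl hU => ?_⟩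
  have h1 := hmax _ hk
  by_cases hkr : k < r'
  · exact hmax r' (by simp only [hS, Finset.mem_filter, Finset.mem_Ioo]; grind)
  · lia

/-- A noncrossing set of chords of the polygon on `p, …, q`, possibly containing `(p, q)` itself
but no side `(k, k + 1)`, has at most as many members as there are vertices strictly between `p`
and `q`. -/
theorem card_le_of_noncrossing {p q : ℕ} {U : Finset (ℕ × ℕ)}
    (hU : ∀ c ∈ U, p ≤ c.1 ∧ c.1 + 2 ≤ c.2 ∧ c.2 ≤ q)
    (hcr : ∀ c ∈ U, ∀ d ∈ U, ¬ Crosses c d) : U.card ≤ q - p - 1 := by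
  choose! f hf using fun (c : ℕ × ℕ) (hc : c ∈ U) => exists_greatest_neighbor U (hU c hc).2.1
  have key : ∀ c ∈ U, ∀ d ∈ U, f c = f d → c.1 ≤ d.1 → c.1 = d.1 := by
    intro c hc d hd h hle
    obtain ⟨-, -, hc3, -⟩ := hf c hc
    obtain ⟨hd1, hd2, -, -⟩ := hf d hd
    by_contra hne
    rcases hc3 with h3 | h3
    · lia
    · exact hcr _ h3 _ hd (Or.inl ⟨by grind, by grind, by grind⟩)
  rw [show q - p - 1 = (Finset.Ioo p q).card by simp]
  refine Finset.card_le_card_of_injOn f (fun c hc => ?_) fun c hc d hd h => ?_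
  · have := hU c hc
    have := hf c hc
    simp only [Finset.coe_Ioo, Set.mem_Ioo]
    lia
  · have h1 : c.1 = d.1 := by
      rcases le_total c.1 d.1 with hle | hle
      · exact key c hc d hd h hle
      · exact (key d hd c hc h.symm hle).symm
    refine Prod.ext h1 ?_
    obtain ⟨-, hc2, -, hc4⟩ := hf c hc
    obtain ⟨-, hd2, -, hd4⟩ := hf d hd
    by_contra hne
    rcases lt_or_gt_of_ne hne with hlt | hlt
    · have := hd4 c.2 hlt (by rw [← h1]; exact hc)
      lia
    · have := hc4 d.2 hlt (by rw [h1]; exact hd)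
      lia

namespace IsTriangulationOn

variable {A : ℕ → ℕ → Prop} {p q : ℕ} {T : Finset (ℕ × ℕ)}

/-- A triangulation is a maximal noncrossing set of diagonals. -/
theorem mem_of_not_crosses (hT : IsTriangulationOn A p q T) {a b : ℕ} (ha : p ≤ a)
    (hab : a + 2 ≤ b) (hb : b ≤ q) (hne : (a, b) ≠ (p, q))
    (hcr : ∀ c ∈ T, ¬ Crosses (a, b) c) : (a, b) ∈ T := by
  classical
  obtain ⟨h1, h2, h3⟩ := hT
  by_contra hmem
  have hpq : (p, q) ∉ T := fun h => (h1 _ h).2.2.2.1 rfl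
  have hcard : (insert (a, b) (insert (p, q) T)).card = T.card + 2 := by
    rw [Finset.card_insert_of_notMem (by simp only [Finset.mem_insert]; tauto),
      Finset.card_insert_of_notMem hpq]
  have := card_le_of_noncrossing (p := p) (q := q) (U := insert (a, b) (insert (p, q) T))
    (by simp only [Finset.mem_insert]; grind)
    (by simp only [Finset.mem_insert]; unfold Crosses at *; grind)
  grind

/-- Every edge of a triangulation that is not a side `(a, a + 1)` is the base of a triangle whose
two other edges belong to the triangulation. -/
theorem exists_apex (hT : IsTriangulationOn A p q T) {a b : ℕ} (hab : a + 2 ≤ b)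
    (h : (a, b) ∈ T ∨ (a, b) = (p, q)) :
    ∃ r, a < r ∧ r < b ∧ (r = a + 1 ∨ (a, r) ∈ T) ∧ (b = r + 1 ∨ (r, b) ∈ T) := by
  obtain ⟨r, har, hrb, hr, hmax⟩ := exists_greatest_neighbor T hab
  refine ⟨r, har, hrb, hr, or_iff_not_imp_left.2 fun hside => ?_⟩
  have hbd : p ≤ a ∧ b ≤ q := by
    rcases h with h | h
    · exact ⟨(hT.1 _ h).1, (hT.1 _ h).2.2.1⟩
    · simp_all
  refine hT.mem_of_not_crosses (by lia) (by lia) hbd.2 (by grind) fun c hc hcr => ?_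
  have hcT := hT.1 c hc
  have hab' : ¬ Crosses (a, b) c := by
    rcases h with h | h
    · by_cases hne : (a, b) = c
      · subst hne; unfold Crosses; lia
      · exact hT.2.1 _ h c hc hne
    · simp only [Prod.mk.injEq] at h; unfold Crosses; lia
  have har' : r = a + 1 ∨ ¬ Crosses (a, r) c := by
    refine hr.imp_right fun hr => ?_
    by_cases hne : (a, r) = c
    · subst hne; unfold Crosses; lia
    · exact hT.2.1 _ hr c hc hne
  have hc1 : c.1 = a → c.2 < b → c.2 ≤ r := by
    rintro rfl hlt
    exact hmax c.2 hlt hc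
  unfold Crosses at *
  simp only at *
  lia

end IsTriangulationOn

/-- The diagonal of which `r` is the apex, in the triangulation of the polygon on `0, …, m` that
consists of the triangles `(0, z, m)`, `(0, x, z)`, `(x, y, z)`, `(x, u, y)`, `(y, w, z)` and fans
around `0`, `u`, `u`, `w`, `w`, `m` filling the six remaining subpolygons. -/
def fanChord (x u y w z m r : ℕ) : ℕ × ℕ :=
  if r < x then (0, r + 1) else if r = x then (0, z) else
  if r < u then (r - 1, u) else if r = u then (x, y) else
  if r < y then (u, r + 1) else if r = y then (x, z) else
  if r < w then (r - 1, w) else if r = w then (y, z) else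
  if r < z then (w, r + 1) else if r = z then (0, m) else (r - 1, m)

/-- The chord with apex `r`, read off from the position of `r`. -/
theorem fanChord_cases (x u y w z m r : ℕ) {a b : ℕ} (h : fanChord x u y w z m r = (a, b)) :
    (r < x ∧ a = 0 ∧ b = r + 1) ∨ (r = x ∧ a = 0 ∧ b = z) ∨
    (x < r ∧ r < u ∧ a = r - 1 ∧ b = u) ∨ (r = u ∧ a = x ∧ b = y) ∨
    (u < r ∧ r < y ∧ a = u ∧ b = r + 1) ∨ (r = y ∧ a = x ∧ b = z) ∨
    (y < r ∧ r < w ∧ a = r - 1 ∧ b = w) ∨ (r = w ∧ a = y ∧ b = z) ∨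
    (w < r ∧ r < z ∧ a = w ∧ b = r + 1) ∨ (r = z ∧ a = 0 ∧ b = m) ∨
    (z < r ∧ a = r - 1 ∧ b = m) := by
  unfold fanChord at h
  split_ifs at h <;> obtain ⟨h_a, h_b⟩ := Prod.mk.inj h <;> clear h <;>
    repeat first | (left; omega) | right
  omega

theorem fanChord_injOn {x u y w z m : ℕ} (h0 : 0 < x) (h1 : x < u) (h2 : u < y) (h3 : y < w)
    (h4 : w < z) (h5 : z < m) : Set.InjOn (fanChord x u y w z m) (Set.Ioo 0 m) := by
  rintro r ⟨hr, hr'⟩ s ⟨hs, hs'⟩ h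
  obtain ⟨⟨a, b⟩, hab⟩ : ∃ c, fanChord x u y w z m r = c := ⟨_, rfl⟩
  have h_r := fanChord_cases x u y w z m r hab
  have h_s := fanChord_cases x u y w z m s (h ▸ hab)
  clear h hab
  rcases h_r with h | h | h | h | h | h | h | h | h | h | h <;> omega

theorem fanChord_not_crosses {x u y w z m r s : ℕ} (h0 : 0 < x) (h1 : x < u) (h2 : u < y)
    (h3 : y < w) (h4 : w < z) (h5 : z < m) (hr : r ∈ Set.Ioo 0 m) (hs : s ∈ Set.Ioo 0 m) :
    ¬ Crosses (fanChord x u y w z m r) (fanChord x u y w z m s) := by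
  have key : ∀ r ∈ Set.Ioo 0 m, ∀ s ∈ Set.Ioo 0 m, ∀ a b c d, fanChord x u y w z m r = (a, b) →
      fanChord x u y w z m s = (c, d) → ¬ (a < c ∧ c < b ∧ b < d) := by
    rintro r ⟨hr, hr'⟩ s ⟨hs, hs'⟩ a b c d hab hcd ⟨hac, hcb, hbd⟩
    replace hab := fanChord_cases x u y w z m r hab
    replace hcd := fanChord_cases x u y w z m s hcd
    rcases hab with h | h | h | h | h | h | h | h | h | h | h <;> omega
  rintro (h | h)
  · exact key r hr s hs _ _ _ _ rfl rfl h
  · exact key s hs r hr _ _ _ _ rfl rfl h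

section Gadget

variable {n : ℕ} {M N : ℕ → ℕ → Prop}

theorem GadgetA.base {a b : ℕ} (h : GadgetA n M N a b) (hab : a < b) : GadgetBase n M N a b := by
  rcases h with h | h
  · exact h
  · unfold GadgetBase at h
    rcases h with h | h | h | h | h | h | h | h | h | h | h | h <;> lia

/-- The apex of a triangle of the graph over a base with one endpoint among `s, x_1, …, x_n` and
the other among `z_1, …, z_n, t`. -/
theorem GadgetBase.apex_cases {a r b : ℕ} (har : GadgetBase n M N a r)
    (hrb : GadgetBase n M N r b) (ha : a ≤ n) (hb : 2 * n + 3 ≤ b)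
    (hab : a = 0 ∨ b ≤ 3 * n + 2) :
    (1 ≤ r ∧ r ≤ n ∧ b ≤ 3 * n + 2) ∨ (2 * n + 3 ≤ r ∧ r ≤ 3 * n + 2) ∨
      ∃ i j k, 1 ≤ i ∧ i ≤ n ∧ 1 ≤ j ∧ j ≤ n ∧ 1 ≤ k ∧ k ≤ n ∧ M i k ∧ N k j := by
  have hM : 1 ≤ r ∧ r ≤ n ∨ r = n + 1 ∨ 2 * n + 3 ≤ r ∨
      ∃ i k, 1 ≤ i ∧ i ≤ n ∧ 1 ≤ k ∧ k ≤ n ∧ r = n + 1 + k ∧ M i k := by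
    unfold GadgetBase at har
    rcases har with h | h | ⟨i, k, h⟩ | h | h | h | h | h | h | h | h | h
    · lia
    · lia
    · exact Or.inr (Or.inr (Or.inr ⟨i, k, by tauto⟩))
    all_goals lia
  have hN : r ≤ n ∧ b ≤ 3 * n + 2 ∨ r = 0 ∨ r = 2 * n + 2 ∨ (2 * n + 3 ≤ r ∧ r ≤ 3 * n + 2) ∨
      ∃ k j, 1 ≤ k ∧ k ≤ n ∧ 1 ≤ j ∧ j ≤ n ∧ r = n + 1 + k ∧ N k j := by
    unfold GadgetBase at hrb
    rcases hrb with h | h | h | ⟨k, j, h⟩ | h | h | h | h | h | h | h | h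
    · lia
    · lia
    · lia
    · exact Or.inr (Or.inr (Or.inr (Or.inr ⟨k, j, by tauto⟩)))
    all_goals lia
  rcases hM with h | h | h | ⟨i, k, hi, hi', hk, hk', rfl, hM⟩
  · lia
  · lia
  · lia
  · rcases hN with h | h | h | h | ⟨k', j, -, -, hj, hj', hkk, hN⟩
    · lia
    · lia
    · lia
    · lia
    · obtain rfl : k = k' := by lia
      exact Or.inr (Or.inr ⟨i, j, k, hi, hi', hj, hj', hk, hk', hM, hN⟩)

/-- A triangulation with an edge from `s, x_1, …, x_n` to `z_1, …, z_n, t` yields witnesses for the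
matrix product. -/
theorem IsTriangulationOn.exists_product_witness {T : Finset (ℕ × ℕ)}
    (hT : IsTriangulationOn (GadgetA n M N) 0 (3 * n + 3) T) {a b : ℕ} (ha : a ≤ n)
    (hb : 2 * n + 3 ≤ b) (hab : a = 0 ∨ b ≤ 3 * n + 2)
    (h : (a, b) ∈ T ∨ (a, b) = (0, 3 * n + 3)) :
    ∃ i j k, 1 ≤ i ∧ i ≤ n ∧ 1 ≤ j ∧ j ≤ n ∧ 1 ≤ k ∧ k ≤ n ∧ M i k ∧ N k j := by
  induction hd : b - a using Nat.strong_induction_on generalizing a b with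
  | _ d ih =>
    have hbase : ∀ c e, c < e → e ≤ 3 * n + 3 → (e = c + 1 ∨ (c, e) ∈ T) →
        GadgetBase n M N c e := by
      rintro c e hlt hle (h | h)
      · exact Or.inl ⟨h, hle⟩
      · exact (hT.1 _ h).2.2.2.2.base hlt
    have hb' : b ≤ 3 * n + 3 := by
      rcases h with h | h
      · exact (hT.1 _ h).2.2.1
      · simp_all
    obtain ⟨r, har, hrb, h1, h2⟩ := hT.exists_apex (by lia) h
    rcases (hbase a r har (by lia) h1).apex_cases (hbase r b hrb hb' h2) ha hb hab with
      ⟨hr, hr', hb2⟩ | ⟨hr, hr'⟩ | hw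
    · exact ih (b - r) (by lia) hr' hb (Or.inr hb2) (Or.inl (h2.resolve_left (by lia))) rfl
    · exact ih (r - a) (by lia) ha hr (Or.inr hr') (Or.inl (h1.resolve_left (by lia))) rfl
    · exact hw

/-- Witnesses `i, j, k` for the matrix product make every chord of the fan triangulation around
the triangle `(x_i, y_k, z_j)` an edge of the graph. -/
theorem gadgetBase_fanChord {i j k r : ℕ} (hi : 1 ≤ i) (hi' : i ≤ n) (hj : 1 ≤ j) (hj' : j ≤ n)
    (hk : 1 ≤ k) (hk' : k ≤ n) (hM : M i k) (hN : N k j) (hr : r ∈ Set.Ioo 0 (3 * n + 3))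
    {a b : ℕ}
    (h : fanChord i (n + 1) (n + 1 + k) (2 * n + 2) (2 * n + 2 + j) (3 * n + 3) r = (a, b)) :
    GadgetBase n M N a b := by
  obtain ⟨hr, hr'⟩ := hr
  unfold GadgetBase
  rcases fanChord_cases _ _ _ _ _ _ _ h with
    h | h | h | ⟨-, h⟩ | h | h | h | ⟨-, h⟩ | h | ⟨-, h⟩ | h
  · iterate 4 right
    exact Or.inl ⟨r + 1, by omega⟩
  · iterate 5 right
    exact Or.inl ⟨j, by omega⟩
  · iterate 7 right
    exact Or.inl ⟨r - 1, by omega⟩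
  · iterate 2 right
    exact Or.inl ⟨i, k, by tauto⟩
  · iterate 8 right
    exact Or.inl ⟨r - n, by omega⟩
  · iterate 6 right
    exact Or.inl ⟨i, j, by omega⟩
  · iterate 9 right
    exact Or.inl ⟨r - 1 - (n + 1), by omega⟩
  · iterate 3 right
    exact Or.inl ⟨k, j, by tauto⟩
  · iterate 10 right
    exact Or.inl ⟨r + 1 - (2 * n + 2), by omega⟩
  · exact Or.inr (Or.inl h)
  · iterate 11 right
    exact ⟨r - 1 - (2 * n + 2), by omega⟩

theorem exists_isTriangulationOn_of_product_witness {i j k : ℕ} (hi : 1 ≤ i) (hi' : i ≤ n)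
    (hj : 1 ≤ j) (hj' : j ≤ n) (hk : 1 ≤ k) (hk' : k ≤ n) (hM : M i k) (hN : N k j) :
    ∃ T, IsTriangulationOn (GadgetA n M N) 0 (3 * n + 3) T := by
  set g := fanChord i (n + 1) (n + 1 + k) (2 * n + 2) (2 * n + 2 + j) (3 * n + 3) with hg
  set I := (Finset.Ioo 0 (3 * n + 3)).erase (2 * n + 2 + j) with hI
  have hIoo : ∀ r ∈ I, r ∈ Set.Ioo 0 (3 * n + 3) := fun r hr => by
    simpa using Finset.mem_of_mem_erase hr
  have hinj : Set.InjOn g (Set.Ioo 0 (3 * n + 3)) :=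
    fanChord_injOn (by lia) (by lia) (by lia) (by lia) (by lia) (by lia)
  refine ⟨I.image g, ?_, ?_, ?_⟩
  · simp only [Finset.mem_image]
    rintro ⟨a, b⟩ ⟨r, hr, hc⟩
    refine ⟨Nat.zero_le _, ?_, ?_, ?_,
      Or.inl (gadgetBase_fanChord hi hi' hj hj' hk hk' hM hN (hIoo r hr) hc)⟩
    all_goals
      replace hc := fanChord_cases _ _ _ _ _ _ _ hc
      simp only [hI, Finset.mem_erase, Finset.mem_Ioo] at hr
      simp only [ne_eq, Prod.mk.injEq]
      rcases hc with h | h | h | h | h | h | h | h | h | h | h <;> omega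
  · simp only [Finset.mem_image]
    rintro c ⟨r, hr, rfl⟩ d ⟨r', hr', rfl⟩ -
    exact fanChord_not_crosses (by lia) (by lia) (by lia) (by lia) (by lia) (by lia)
      (hIoo r hr) (hIoo r' hr')
  · rw [Finset.card_image_of_injOn fun r hr r' hr' h => hinj (hIoo r hr) (hIoo r' hr') h,
      hI, Finset.card_erase_of_mem (by simp only [Finset.mem_Ioo]; lia), Nat.card_Ioo]
    lia

end Gadget

/-- For the graph `A` on the convex `(3n+4)`-gon built from matrices `M` and `N`,
the full convex `(3n+4)`-gon (on vertices `0, …, 3n+3`) has a triangulation within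
`A`, i.e. a set of `(3n+4) - 3` pairwise noncrossing diagonals all satisfying `A`,
iff there are `i, j, k ∈ {1,…,n}` with `M(i,k)` and `N(k,j)`. -/
theorem stmt_8 (n : ℕ) (hn : 1 ≤ n) (M N : ℕ → ℕ → Prop) :
    (∃ T : Finset (ℕ × ℕ),
        IsTriangulationOn (GadgetA n M N) 0 (3 * n + 3) T) ↔
      ∃ i j k, 1 ≤ i ∧ i ≤ n ∧ 1 ≤ j ∧ j ≤ n ∧ 1 ≤ k ∧ k ≤ n ∧ M i k ∧ N k j := by
  constructor
  · rintro ⟨T, hT⟩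
    exact hT.exists_product_witness (Nat.zero_le n) (by lia) (Or.inl rfl) (Or.inr rfl)
  · rintro ⟨i, j, k, hi, hi', hj, hj', hk, hk', hM, hN⟩
    exact exists_isTriangulationOn_of_product_witness hi hi' hj hj' hk hk' hM hN
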